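/- Let μ : ℕ → Σ be an infinite word over a finite alphabet that is uniformly recurrent and not periodic. Then the factor-closed class Fac(μ) of finite factors of μ has infinitely many bounds. -/

import Mathlib

/-- The set of finite factors of the infinite word `u : ℕ → A`. -/
def FacN {A : Type*} (u : ℕ → A) : Set (List A) :=
  {v | ∃ i : ℕ, v = (List.range v.length).map fun k => u (i + k)}

/-- A bound of a factor-closed class `C` of finite words: a word not in `C` all of whose
proper factors belong to `C`. -/
def IsBound {A : Type*} (C : Set (List A)) (v : List A) : Prop :=
  v ∉ C ∧ ∀ w : List A, w <:+: v → w ≠ v → w ∈ C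

/-- `u` is uniformly recurrent: for every `n` there is `m` such that every factor of `u` of
length `n` occurs as a factor of every factor of `u` of length `m`. -/
def UnifRec {A : Type*} (u : ℕ → A) : Prop :=
  ∀ n : ℕ, ∃ m : ℕ, ∀ v ∈ FacN u, v.length = n → ∀ w ∈ FacN u, w.length = m → v <:+: w

theorem mem_facN_iff {A : Type*} {u : ℕ → A} {v : List A} :
    v ∈ FacN u ↔ ∃ i : ℕ, ∀ k (h : k < v.length), v[k] = u (i + k) := by
  constructor
  · rintro ⟨i, hi⟩
    refine ⟨i, fun k h => ?_⟩
    have := List.getElem_of_eq hi h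
    simpa using this
  · rintro ⟨i, hi⟩
    refine ⟨i, List.ext_getElem (by simp) fun k h _ => ?_⟩
    simpa using hi k h

theorem map_range_mem_facN {A : Type*} (u : ℕ → A) (i n : ℕ) :
    ((List.range n).map fun k => u (i + k)) ∈ FacN u :=
  ⟨i, by simp⟩

theorem mem_facN_of_infix {A : Type*} {u : ℕ → A} {v w : List A}
    (hw : w <:+: v) (hv : v ∈ FacN u) : w ∈ FacN u := by
  obtain ⟨s, t, rfl⟩ := hw
  obtain ⟨i, hi⟩ := mem_facN_iff.1 hv
  refine mem_facN_iff.2 ⟨i + s.length, fun k h => ?_⟩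
  have := hi (s.length + k) (by simp; omega)
  rw [List.getElem_append_left (by simp; omega), List.getElem_append_right (by omega)] at this
  simpa [Nat.add_assoc] using this

/-- Every word outside `C` contains a bound of `C`. -/
theorem exists_isBound_infix {A : Type*} {C : Set (List A)} (v : List A) (hv : v ∉ C) :
    ∃ w, w <:+: v ∧ IsBound C w := by
  induction hn : v.length using Nat.strong_induction_on generalizing v with
  | _ n ih =>
    by_cases hb : IsBound C v
    · exact ⟨v, List.infix_refl v, hb⟩
    · simp only [IsBound, not_and, not_forall] at hb
      obtain ⟨w, hwv, hne, hw⟩ := hb hv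
      have hlt : w.length < n := by
        have hle := hwv.length_le
        have : w.length ≠ v.length := fun h => hne (hwv.eq_of_length h)
        omega
      obtain ⟨b, hb, hbb⟩ := ih _ hlt w hw rfl
      exact ⟨b, hb.trans hwv, hbb⟩

/-- If `u` has local period `p` on the `N` places following `i`, it agrees there with the
periodic extension of its block of length `p` at `i`. -/
theorem eq_mod_of_local_period {A : Type*} {u : ℕ → A} {i p N : ℕ} (hp : 0 < p)
    (h : ∀ t < N, u (i + t + p) = u (i + t)) (t : ℕ) (ht : t < p + N) :
    u (i + t) = u (i + t % p) := by
  induction t using Nat.strong_induction_on with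
  | _ t ih =>
    rcases lt_or_ge t p with htp | htp
    · rw [Nat.mod_eq_of_lt htp]
    · obtain ⟨s, rfl⟩ := Nat.exists_eq_add_of_le' htp
      rw [Nat.add_mod_right, ← ih s (by omega) (by omega), ← h s (by omega), Nat.add_assoc]

theorem exists_repeated_block {A : Type*} [Finite A] (u : ℕ → A) (N : ℕ) :
    ∃ i p, 0 < p ∧ ∀ t < N, u (i + t + p) = u (i + t) := by
  obtain ⟨a, b, hab, h⟩ :=
    Finite.exists_ne_map_eq_of_infinite fun (i : ℕ) (t : Fin N) => u (i + t)
  wlog hlt : a < b generalizing a b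
  · exact this b a hab.symm h.symm (by omega)
  refine ⟨a, b - a, by omega, fun t ht => ?_⟩
  have := congrFun h ⟨t, ht⟩
  simp only at this
  rw [this]
  congr 1
  omega

theorem stmt2 {A : Type*} [Finite A] (μ : ℕ → A) (hur : UnifRec μ)
    (hnp : ¬ ∃ p > 0, ∀ i : ℕ, μ (i + p) = μ i) :
    {v : List A | IsBound (FacN μ) v}.Infinite := by
  intro hfin
  obtain ⟨N, hN⟩ := (hfin.image List.length).bddAbove
  obtain ⟨i, p, hp, hper⟩ := exists_repeated_block μ N
  set x : ℕ → A := fun k => μ (i + k % p) with hx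
  have hsub : ∀ w ∈ FacN x, w ∈ FacN μ := by
    intro w hw
    by_contra hwμ
    obtain ⟨b, hbw, hb⟩ := exists_isBound_infix w hwμ
    have hbN : b.length ≤ N := hN ⟨b, hb, rfl⟩
    obtain ⟨k, hk⟩ := mem_facN_iff.1 (mem_facN_of_infix hbw hw)
    refine hb.1 (mem_facN_iff.2 ⟨i + k % p, fun l hl => ?_⟩)
    have hkp := Nat.mod_lt k hp
    rw [hk l hl, Nat.add_assoc, eq_mod_of_local_period hp hper (k % p + l) (by omega)]
    simp [hx]
  refine hnp ⟨p, hp, fun j => ?_⟩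
  obtain ⟨m, hm⟩ := hur (p + 1)
  have hinf := hm _ (map_range_mem_facN μ j (p + 1)) (by simp) _
    (hsub _ (map_range_mem_facN x 0 m)) (by simp)
  obtain ⟨k, hk⟩ := mem_facN_iff.1 (mem_facN_of_infix hinf (map_range_mem_facN x 0 m))
  have h0 := hk 0 (by simp)
  have h1 := hk p (by simp)
  simp only [List.getElem_map, List.getElem_range, Nat.add_zero] at h0 h1
  rw [h0, h1]
  simp [hx]
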